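/- Let φ: ℝ² → ℝ be a smooth (C⁴) function compactly supported in the open unit disk, and let f = d²φ, i.e. f11 = ∂²φ/∂x1², f12 = ∂²φ/∂x1∂x2, f22 = ∂²φ/∂x2². Then for every x ∈ ℝ², φ(x) = (1/(2·u2))·∫_0^∞ Lf(x + s·e2) ds and φ(x) = -(1/(2·u2))·∫_0^∞ Mf(x + s·e1) ds. -/

import Mathlib

open MeasureTheory

noncomputable section

/-- Rotation of a vector by 90 degrees: `w⊥ = (-w2, w1)`. -/
def perp (w : ℝ × ℝ) : ℝ × ℝ := (-w.2, w.1)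

/-- Divergent beam transform `X_w h (x) = ∫_0^∞ h(x + t w) dt`. -/
def Xray (w : ℝ × ℝ) (h : ℝ × ℝ → ℝ) (x : ℝ × ℝ) : ℝ :=
  ∫ t in Set.Ioi (0:ℝ), h (x + t • w)

/-- First moment divergent beam transform `X¹_w h (x) = ∫_0^∞ t·h(x + t w) dt`. -/
def Xray1 (w : ℝ × ℝ) (h : ℝ × ℝ → ℝ) (x : ℝ × ℝ) : ℝ :=
  ∫ t in Set.Ioi (0:ℝ), t * h (x + t • w)

/-- Directional derivative `D_w h = w1 ∂h/∂x1 + w2 ∂h/∂x2`. -/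
def Dw (w : ℝ × ℝ) (h : ℝ × ℝ → ℝ) (x : ℝ × ℝ) : ℝ :=
  fderiv ℝ h x w

/-- Partial derivative in the first coordinate. -/
def pdx (h : ℝ × ℝ → ℝ) : ℝ × ℝ → ℝ := Dw (1, 0) h

/-- Partial derivative in the second coordinate. -/
def pdy (h : ℝ × ℝ → ℝ) : ℝ × ℝ → ℝ := Dw (0, 1) h

/-- The open unit disk in ℝ². -/
def unitDisk : Set (ℝ × ℝ) := {x | x.1 ^ 2 + x.2 ^ 2 < 1}

/-- `⟨f, w²⟩ = f11 w1² + 2 f12 w1 w2 + f22 w2²`. -/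
def proj2 (f11 f12 f22 : ℝ × ℝ → ℝ) (w : ℝ × ℝ) (x : ℝ × ℝ) : ℝ :=
  f11 x * w.1 ^ 2 + 2 * f12 x * w.1 * w.2 + f22 x * w.2 ^ 2

/-- `⟨f, w ⊙ w⊥⟩ = -f11 w1 w2 + f12 (w1² - w2²) + f22 w1 w2`. -/
def projMix (f11 f12 f22 : ℝ × ℝ → ℝ) (w : ℝ × ℝ) (x : ℝ × ℝ) : ℝ :=
  -(f11 x) * w.1 * w.2 + f12 x * (w.1 ^ 2 - w.2 ^ 2) + f22 x * w.1 * w.2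

/-- V-line transform of a scalar function. -/
def Vlt (u v : ℝ × ℝ) (h : ℝ × ℝ → ℝ) (x : ℝ × ℝ) : ℝ := Xray u h x + Xray v h x

/-- Longitudinal V-line transform. -/
def Lf (u v : ℝ × ℝ) (f11 f12 f22 : ℝ × ℝ → ℝ) (x : ℝ × ℝ) : ℝ :=
  Xray u (proj2 f11 f12 f22 u) x + Xray v (proj2 f11 f12 f22 v) x

/-- Transverse V-line transform. -/
def Tf (u v : ℝ × ℝ) (f11 f12 f22 : ℝ × ℝ → ℝ) (x : ℝ × ℝ) : ℝ :=
  Xray u (proj2 f11 f12 f22 (perp u)) x + Xray v (proj2 f11 f12 f22 (perp v)) x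

/-- Mixed V-line transform. -/
def Mf (u v : ℝ × ℝ) (f11 f12 f22 : ℝ × ℝ → ℝ) (x : ℝ × ℝ) : ℝ :=
  Xray u (projMix f11 f12 f22 u) x + Xray v (projMix f11 f12 f22 v) x

/-- First moment longitudinal V-line transform. -/
def L1f (u v : ℝ × ℝ) (f11 f12 f22 : ℝ × ℝ → ℝ) (x : ℝ × ℝ) : ℝ :=
  Xray1 u (proj2 f11 f12 f22 u) x + Xray1 v (proj2 f11 f12 f22 v) x

/-- Fundamental theorem of calculus along a ray, for compactly supported functions. -/
theorem Xray_Dw_self {g : ℝ × ℝ → ℝ} (hg : ContDiff ℝ 1 g) (hc : HasCompactSupport g)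
    {w : ℝ × ℝ} (hw : w ≠ 0) (x : ℝ × ℝ) : Xray w (Dw w g) x = -g x := by
  have hline : Topology.IsClosedEmbedding fun t : ℝ => x + t • w :=
    (Homeomorph.addLeft x).isClosedEmbedding.comp (isClosedEmbedding_smul_left hw)
  have hderiv (t : ℝ) : deriv (fun t : ℝ => g (x + t • w)) t = Dw w g (x + t • w) := by
    have hl : HasDerivAt (fun t : ℝ => x + t • w) w t := by
      simpa using ((hasDerivAt_id t).smul_const w).const_add x
    exact ((hg.differentiable one_ne_zero _).hasFDerivAt.comp_hasDerivAt t hl).deriv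
  have hsmooth : ContDiff ℝ 1 fun t : ℝ => g (x + t • w) := by fun_prop
  have key := HasCompactSupport.integral_Ioi_deriv_eq hsmooth
    (hc.comp_isClosedEmbedding hline) 0
  simpa [Xray, hderiv] using key

theorem Dw_eq_pdx_add_pdy (h : ℝ × ℝ → ℝ) (w x : ℝ × ℝ) :
    Dw w h x = w.1 * pdx h x + w.2 * pdy h x := by
  have hw : w = w.1 • ((1 : ℝ), (0 : ℝ)) + w.2 • ((0 : ℝ), (1 : ℝ)) := by ext <;> simp
  simp only [pdx, pdy, Dw]
  conv_lhs => rw [hw, map_add, map_smul, map_smul]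
  rfl

theorem contDiff_Dw {φ : ℝ × ℝ → ℝ} (hφ : ContDiff ℝ 2 φ) (w : ℝ × ℝ) :
    ContDiff ℝ 1 (Dw w φ) :=
  (hφ.fderiv_right (m := 1) (by norm_num)).clm_apply contDiff_const

theorem hasCompactSupport_Dw {φ : ℝ × ℝ → ℝ} (hc : HasCompactSupport φ) (w : ℝ × ℝ) :
    HasCompactSupport (Dw w φ) :=
  hc.fderiv_apply ℝ w

theorem Dw_Dw {φ : ℝ × ℝ → ℝ} (hφ : ContDiff ℝ 2 φ) (w z x : ℝ × ℝ) :
    Dw w (Dw z φ) x = fderiv ℝ (fderiv ℝ φ) x w z := by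
  have hd : DifferentiableAt ℝ (fderiv ℝ φ) x :=
    (hφ.fderiv_right (m := 1) (by norm_num)).differentiable one_ne_zero x
  change fderiv ℝ (fun y => fderiv ℝ φ y z) x w = _
  rw [fderiv_clm_apply hd (differentiableAt_const z)]
  simp

theorem Dw_comm {φ : ℝ × ℝ → ℝ} (hφ : ContDiff ℝ 2 φ) (w z x : ℝ × ℝ) :
    Dw w (Dw z φ) x = Dw z (Dw w φ) x := by
  rw [Dw_Dw hφ, Dw_Dw hφ]
  exact (hφ.contDiffAt.isSymmSndFDerivAt (by simp)).eq w z

theorem Dw_Dw_eq_hessian {φ : ℝ × ℝ → ℝ} (hφ : ContDiff ℝ 2 φ) (w z x : ℝ × ℝ) :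
    Dw w (Dw z φ) x = pdx (pdx φ) x * (w.1 * z.1) +
      pdx (pdy φ) x * (w.1 * z.2 + w.2 * z.1) + pdy (pdy φ) x * (w.2 * z.2) := by
  have hz (y : ℝ × ℝ) : pdx (Dw z φ) y = z.1 * pdx (pdx φ) y + z.2 * pdx (pdy φ) y := by
    rw [pdx, Dw_comm hφ, Dw_eq_pdx_add_pdy]
    congr 2
    exact Dw_comm hφ _ _ _
  have hz' (y : ℝ × ℝ) : pdy (Dw z φ) y = z.1 * pdx (pdy φ) y + z.2 * pdy (pdy φ) y := by
    rw [pdy, Dw_comm hφ, Dw_eq_pdx_add_pdy]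
    rfl
  rw [Dw_eq_pdx_add_pdy, hz, hz']
  ring

theorem proj2_hessian {φ : ℝ × ℝ → ℝ} (hφ : ContDiff ℝ 2 φ) (w : ℝ × ℝ) :
    proj2 (pdx (pdx φ)) (pdx (pdy φ)) (pdy (pdy φ)) w = Dw w (Dw w φ) := by
  ext x
  rw [Dw_Dw_eq_hessian hφ, proj2]
  ring

theorem projMix_hessian {φ : ℝ × ℝ → ℝ} (hφ : ContDiff ℝ 2 φ) (w : ℝ × ℝ) :
    projMix (pdx (pdx φ)) (pdx (pdy φ)) (pdy (pdy φ)) w = Dw w (Dw (perp w) φ) := by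
  ext x
  rw [Dw_Dw_eq_hessian hφ, projMix, perp]
  ring

theorem Xray_const_mul (c : ℝ) (w : ℝ × ℝ) (h : ℝ × ℝ → ℝ) (x : ℝ × ℝ) :
    Xray w (fun y => c * h y) x = c * Xray w h x :=
  integral_const_mul c _

theorem hasCompactSupport_of_tsupport_subset_unitDisk {φ : ℝ × ℝ → ℝ}
    (h : tsupport φ ⊆ unitDisk) : HasCompactSupport φ := by
  refine (isCompact_closedBall (0 : ℝ × ℝ) 1).of_isClosed_subset (isClosed_tsupport φ) ?_
  intro y hy
  have hy' : y.1 ^ 2 + y.2 ^ 2 < 1 := h hy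
  rw [mem_closedBall_zero_iff, Prod.norm_def, max_le_iff, Real.norm_eq_abs, Real.norm_eq_abs,
    ← sq_le_one_iff_abs_le_one, ← sq_le_one_iff_abs_le_one]
  constructor <;> nlinarith [sq_nonneg y.1, sq_nonneg y.2]

theorem stmt_0 (u1 u2 : ℝ) (hu1 : 0 < u1) (hu2 : 0 < u2) (huv : u1 ^ 2 + u2 ^ 2 = 1)
    (φ : ℝ × ℝ → ℝ) (hφ : ContDiff ℝ 4 φ) (hφsupp : tsupport φ ⊆ unitDisk)
    (f11 f12 f22 : ℝ × ℝ → ℝ)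
    (hf11 : f11 = pdx (pdx φ)) (hf12 : f12 = pdx (pdy φ)) (hf22 : f22 = pdy (pdy φ)) :
    ∀ x : ℝ × ℝ,
      φ x = (1 / (2 * u2)) * Xray (0, 1) (Lf (u1, u2) (-u1, u2) f11 f12 f22) x ∧
      φ x = -(1 / (2 * u2)) * Xray (1, 0) (Mf (u1, u2) (-u1, u2) f11 f12 f22) x := by
  subst hf11 hf12 hf22
  intro x
  have hφ2 : ContDiff ℝ 2 φ := hφ.of_le (by norm_num)
  have hφ1 : ContDiff ℝ 1 φ := hφ.of_le (by norm_num)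
  have hc := hasCompactSupport_of_tsupport_subset_unitDisk hφsupp
  have hu : (u1, u2) ≠ 0 := fun h => hu2.ne' (congrArg Prod.snd h)
  have hv : (-u1, u2) ≠ 0 := fun h => hu2.ne' (congrArg Prod.snd h)
  have hray {w : ℝ × ℝ} (hw : w ≠ 0) (z y : ℝ × ℝ) :
      Xray w (Dw w (Dw z φ)) y = -Dw z φ y :=
    Xray_Dw_self (contDiff_Dw hφ2 z) (hasCompactSupport_Dw hc z) hw y
  have hL : Lf (u1, u2) (-u1, u2) (pdx (pdx φ)) (pdx (pdy φ)) (pdy (pdy φ)) =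
      fun y => -(2 * u2) * Dw (0, 1) φ y := by
    ext y
    rw [Lf, proj2_hessian hφ2, proj2_hessian hφ2, hray hu, hray hv, Dw_eq_pdx_add_pdy,
      Dw_eq_pdx_add_pdy φ (-u1, u2), pdy]
    ring
  have hM : Mf (u1, u2) (-u1, u2) (pdx (pdx φ)) (pdx (pdy φ)) (pdy (pdy φ)) =
      fun y => (2 * u2) * Dw (1, 0) φ y := by
    ext y
    rw [Mf, projMix_hessian hφ2, projMix_hessian hφ2, hray hu, hray hv, Dw_eq_pdx_add_pdy,
      Dw_eq_pdx_add_pdy φ (perp (-u1, u2)), perp, perp, pdx]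
    ring
  rw [hL, hM, Xray_const_mul, Xray_const_mul, Xray_Dw_self hφ1 hc (by simp),
    Xray_Dw_self hφ1 hc (by simp)]
  constructor <;> field_simp
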